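/- arXiv:1510.03998 — 3 statements merged into one kernel-verified Lean document; each statement's English description precedes it below -/
import Mathlib

section
/- Let G be an interval graph with ν(G) = k. Then the pair (ν(G_β), ν(G_γ)) is one of (k, k), (k, k+1), (k+1, k+1); equivalently, the triple (ν(G_α)−1, ν(G_β)−1, ν(G_γ)−1) is one of (k, k−1, k−1), (k, k−1, k), (k, k, k). -/
open Set

/-- An interval representation of a simple graph `G`: each vertex `v` gets a nonempty
closed interval `[l v, r v] ⊆ ℝ`, and two distinct vertices are adjacent iff their
intervals intersect. -/
structure IntervalRep {V : Type*} (G : SimpleGraph V) where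
  l : V → ℝ
  r : V → ℝ
  le : ∀ v, l v ≤ r v
  adj_iff : ∀ u v : V, u ≠ v →
    (G.Adj u v ↔ (Icc (l u) (r u) ∩ Icc (l v) (r v)).Nonempty)

namespace IntervalRep

variable {V : Type*} {G : SimpleGraph V}

/-- The interval of a vertex. -/
def itv (R : IntervalRep G) (v : V) : Set ℝ := Icc (R.l v) (R.r v)

/-- The nesting `ν(R)`: the maximum length of a chain of strictly nested vertex intervals. -/
noncomputable def nesting (R : IntervalRep G) : ℕ :=
  sSup {k : ℕ | ∃ f : Fin k → V, ∀ i j : Fin k, i < j → R.itv (f i) ⊂ R.itv (f j)}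

/-- `ν_R(x)`: the maximum length of a chain of strictly nested vertex intervals whose
outermost interval is `I(x)` (counting `x` itself). -/
noncomputable def nuAt (R : IntervalRep G) (x : V) : ℕ :=
  sSup {k : ℕ | ∃ f : Fin k → V,
    (∀ i j : Fin k, i < j → R.itv (f i) ⊂ R.itv (f j)) ∧
    ∃ h : 0 < k, f ⟨k - 1, by omega⟩ = x}

end IntervalRep

/-- A graph is an interval graph if it admits an interval representation. -/
def IsIntervalGraph {V : Type*} (G : SimpleGraph V) : Prop := Nonempty (IntervalRep G)

/-- The nesting number `ν(G)`: the minimum nesting over all interval representations. -/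
noncomputable def nu {V : Type*} (G : SimpleGraph V) : ℕ :=
  sInf {n : ℕ | ∃ R : IntervalRep G, R.nesting = n}

/-- `G_α`: add vertices `u, a₁, a₂, b₁, b₂` (coded as `0,1,2,3,4`), with `u` adjacent to all
of `G` and to `a₁, b₁`; `a₁ ~ a₂` and `b₁ ~ b₂`. -/
def Galpha {V : Type*} (G : SimpleGraph V) : SimpleGraph (V ⊕ Fin 5) :=
  SimpleGraph.fromRel fun x y =>
    match x, y with
    | Sum.inl a, Sum.inl b => G.Adj a b
    | Sum.inl _, Sum.inr i => i = 0
    | Sum.inr _, Sum.inl _ => False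
    | Sum.inr i, Sum.inr j =>
        i = 0 ∧ j = 1 ∨ i = 1 ∧ j = 2 ∨ i = 0 ∧ j = 3 ∨ i = 3 ∧ j = 4

/-- `G_β`: add vertices `u, a₁, a₂` (coded as `0,1,2`), with `u` adjacent to all of `G`
and to `a₁`; `a₁ ~ a₂`. -/
def Gbeta {V : Type*} (G : SimpleGraph V) : SimpleGraph (V ⊕ Fin 3) :=
  SimpleGraph.fromRel fun x y =>
    match x, y with
    | Sum.inl a, Sum.inl b => G.Adj a b
    | Sum.inl _, Sum.inr i => i = 0
    | Sum.inr _, Sum.inl _ => False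
    | Sum.inr i, Sum.inr j => i = 0 ∧ j = 1 ∨ i = 1 ∧ j = 2

/-- `G_γ`: add vertices `u, v, a₁, a₂, b₁, b₂` (coded as `0,1,2,3,4,5`), with `u ~ v`, both
adjacent to all of `G`; `u ~ a₁`, `a₁ ~ a₂`, `v ~ b₁`, `b₁ ~ b₂`. -/
def Ggamma {V : Type*} (G : SimpleGraph V) : SimpleGraph (V ⊕ Fin 6) :=
  SimpleGraph.fromRel fun x y =>
    match x, y with
    | Sum.inl a, Sum.inl b => G.Adj a b
    | Sum.inl _, Sum.inr i => i = 0 ∨ i = 1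
    | Sum.inr _, Sum.inl _ => False
    | Sum.inr i, Sum.inr j =>
        i = 0 ∧ j = 1 ∨ i = 0 ∧ j = 2 ∨ i = 2 ∧ j = 3 ∨ i = 1 ∧ j = 4 ∨ i = 4 ∧ j = 5

/-- The disjoint union of a family of graphs, on the sigma type of their vertex sets. -/
def sigmaGraph {p : ℕ} {V : Fin p → Type*} (G : ∀ i, SimpleGraph (V i)) :
    SimpleGraph (Σ i, V i) :=
  SimpleGraph.fromRel fun x y => ∃ h : x.1 = y.1, (G y.1).Adj (h ▸ x.2) y.2

/-- The graph obtained from `H` by adding one new vertex adjacent to every vertex of `H`. -/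
def joinVertex {W : Type*} (H : SimpleGraph W) : SimpleGraph (W ⊕ Unit) :=
  SimpleGraph.fromRel fun x y =>
    match x, y with
    | Sum.inl a, Sum.inl b => H.Adj a b
    | Sum.inl _, Sum.inr _ => True
    | _, _ => False

theorem icc_inter_aux {a b c d : ℝ} (h : a ≤ b) (h' : c ≤ d) :
    (Icc a b ∩ Icc c d).Nonempty ↔ a ≤ d ∧ c ≤ b := by
  rw [Icc_inter_Icc, nonempty_Icc, sup_le_iff, le_inf_iff, le_inf_iff]
  tauto

theorem chain_bdd {V : Type*} [Finite V] {G : SimpleGraph V} (R : IntervalRep G) :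
    BddAbove {k : ℕ | ∃ f : Fin k → V, ∀ i j : Fin k, i < j → R.itv (f i) ⊂ R.itv (f j)} := by
  refine ⟨Nat.card V, ?_⟩
  rintro k ⟨f, hf⟩
  have hi : Function.Injective f := by
    intro i j hij
    rcases lt_trichotomy i j with h | h | h
    · have := hf i j h
      rw [hij] at this
      exact absurd this (ssubset_irrefl _)
    · exact h
    · have := hf j i h
      rw [hij] at this
      exact absurd this (ssubset_irrefl _)
  simpa using Nat.card_le_card_of_injective f hi

/-- Restriction of a representation to an induced subgraph. -/
def restrictRep {V W : Type*} {G : SimpleGraph V} {H : SimpleGraph W} (e : G ↪g H)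
    (R : IntervalRep H) : IntervalRep G where
  l v := R.l (e v)
  r v := R.r (e v)
  le v := R.le _
  adj_iff u v h := by
    rw [← R.adj_iff _ _ (e.injective.ne h)]
    exact e.map_adj_iff.symm

theorem restrict_nesting {V W : Type*} [Finite W] {G : SimpleGraph V} {H : SimpleGraph W}
    (e : G ↪g H) (R : IntervalRep H) : (restrictRep e R).nesting ≤ R.nesting := by
  refine csSup_le ⟨0, Fin.elim0, fun i => i.elim0⟩ ?_
  rintro k ⟨f, hf⟩
  exact le_csSup (chain_bdd R) ⟨fun i => e (f i), hf⟩

theorem nu_mono {V W : Type*} [Finite W] {G : SimpleGraph V} {H : SimpleGraph W}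
    (e : G ↪g H) (hH : IsIntervalGraph H) : nu G ≤ nu H := by
  obtain ⟨R0⟩ := hH
  obtain ⟨R, hR⟩ : nu H ∈ {n : ℕ | ∃ R : IntervalRep H, R.nesting = n} :=
    Nat.sInf_mem ⟨_, R0, rfl⟩
  calc nu G ≤ (restrictRep e R).nesting := Nat.sInf_le ⟨_, rfl⟩
    _ ≤ R.nesting := restrict_nesting e R
    _ = nu H := hR

def embBeta {V : Type*} (G : SimpleGraph V) : G ↪g Gbeta G where
  toFun := Sum.inl
  inj' := Sum.inl_injective
  map_rel_iff' := by
    intro a b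
    have h1 : G.Adj a b → a ≠ b := fun h => h.ne
    have h2 : G.Adj b a ↔ G.Adj a b := G.adj_comm _ _
    simp [Gbeta]
    tauto

def embGamma {V : Type*} (G : SimpleGraph V) : Gbeta G ↪g Ggamma G where
  toFun := Sum.map id ![0, 2, 3]
  inj' := Sum.map_injective.2 ⟨Function.injective_id, by decide⟩
  map_rel_iff' := by
    rintro (a | i) (b | j)
    · simp [Gbeta, Ggamma]
    · fin_cases j <;> simp [Gbeta, Ggamma]
    · fin_cases i <;> simp [Gbeta, Ggamma]
    · fin_cases i <;> fin_cases j <;> simp [Gbeta, Ggamma]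

/-- Extension of a representation of `G` to `G_γ`. -/
def extendRep {V : Type*} {G : SimpleGraph V} (R : IntervalRep G) (M : ℝ) (hM : 0 ≤ M)
    (hl : ∀ v, -M ≤ R.l v) (hr : ∀ v, R.r v ≤ M) : IntervalRep (Ggamma G) where
  l := Sum.elim R.l ![-M-1, -M, -M-2, -M-3, M+1, M+2]
  r := Sum.elim R.r ![M, M+1, -M-1, -M-2, M+2, M+3]
  le := by
    rintro (v | i)
    · exact R.le v
    · fin_cases i <;> simp <;> linarith
  adj_iff := by
    have key : ∀ i : Fin 6, (![-M-1, -M, -M-2, -M-3, M+1, M+2] : Fin 6 → ℝ) i ≤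
        (![M, M+1, -M-1, -M-2, M+2, M+3] : Fin 6 → ℝ) i := by
      intro i
      fin_cases i <;> simp <;> linarith
    rintro (a | i) (b | j) h
    · have hab : a ≠ b := fun h' => h (by rw [h'])
      have := R.adj_iff a b hab
      simp only [Sum.elim_inl]
      rw [← this]
      simp [Ggamma, hab, G.adj_comm b a]
    · have h1 := hl a
      have h2 := hr a
      have h3 := R.le a
      simp only [Sum.elim_inl, Sum.elim_inr]
      rw [icc_inter_aux h3 (key j)]
      fin_cases j <;> simp [Ggamma] <;> (try constructor) <;> intros <;> linarith
    · have h1 := hl b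
      have h2 := hr b
      have h3 := R.le b
      simp only [Sum.elim_inl, Sum.elim_inr]
      rw [icc_inter_aux (key i) h3]
      fin_cases i <;> simp [Ggamma] <;> (try constructor) <;> intros <;> linarith
    · simp only [Sum.elim_inr]
      rw [icc_inter_aux (key i) (key j)]
      fin_cases i <;> fin_cases j <;> simp [Ggamma] at h ⊢ <;> (try constructor) <;> intros <;>
        linarith

theorem extend_inner {V : Type*} {G : SimpleGraph V} (R : IntervalRep G) (M : ℝ) (hM : 0 ≤ M)
    (hl : ∀ v, -M ≤ R.l v) (hr : ∀ v, R.r v ≤ M) (x y : V ⊕ Fin 6)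
    (h : (extendRep R M hM hl hr).itv x ⊂ (extendRep R M hM hl hr).itv y) :
    ∃ v, x = Sum.inl v := by
  rcases x with v | i
  · exact ⟨v, rfl⟩
  exfalso
  have hs := h.1
  unfold IntervalRep.itv at hs
  rw [Icc_subset_Icc_iff ((extendRep R M hM hl hr).le _)] at hs
  rcases y with v | j
  · have h1 := hl v
    have h2 := hr v
    fin_cases i <;> simp [extendRep] at hs <;> linarith
  · by_cases hij : i = j
    · subst hij
      exact ssubset_irrefl _ h
    · fin_cases i <;> fin_cases j <;> simp [extendRep] at hs hij <;> linarith

theorem extend_nesting {V : Type*} [Finite V] {G : SimpleGraph V} (R : IntervalRep G) (M : ℝ)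
    (hM : 0 ≤ M) (hl : ∀ v, -M ≤ R.l v) (hr : ∀ v, R.r v ≤ M) :
    (extendRep R M hM hl hr).nesting ≤ R.nesting + 1 := by
  refine csSup_le ⟨0, Fin.elim0, fun i => i.elim0⟩ ?_
  rintro k ⟨f, hf⟩
  rcases k with _ | m
  · omega
  have hin : ∀ i : Fin m, ∃ v, f i.castSucc = Sum.inl v := fun i =>
    extend_inner R M hM hl hr _ _ (hf i.castSucc (Fin.last m) (Fin.castSucc_lt_last i))
  choose g hg using hin
  have : m ≤ R.nesting := by
    refine le_csSup (chain_bdd R) ⟨g, fun i j hij => ?_⟩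
    have := hf i.castSucc j.castSucc (by simpa using hij)
    rw [hg, hg] at this
    exact this
  omega

theorem exists_extend {V : Type*} [Finite V] {G : SimpleGraph V} (R : IntervalRep G) :
    ∃ S : IntervalRep (Ggamma G), S.nesting ≤ R.nesting + 1 := by
  obtain ⟨a, ha⟩ := (Set.finite_range R.l).bddBelow
  obtain ⟨b, hb⟩ := (Set.finite_range R.r).bddAbove
  have h1 : ∀ v, a ≤ R.l v := fun v => ha ⟨v, rfl⟩
  have h2 : ∀ v, R.r v ≤ b := fun v => hb ⟨v, rfl⟩
  refine ⟨extendRep R (|a| + |b|) (by positivity) (fun v => ?_) (fun v => ?_),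
    extend_nesting _ _ _ _ _⟩
  · linarith [h1 v, neg_abs_le a, abs_nonneg b]
  · linarith [h2 v, le_abs_self b, abs_nonneg a]

/-- the pair `(ν(G_β), ν(G_γ))` is one of `(k,k)`, `(k,k+1)`, `(k+1,k+1)`. -/
theorem stmt_1 {V : Type*} [Fintype V] (G : SimpleGraph V) (hG : IsIntervalGraph G)
    (k : ℕ) (hk : nu G = k) :
    (nu (Gbeta G) = k ∧ nu (Ggamma G) = k) ∨
    (nu (Gbeta G) = k ∧ nu (Ggamma G) = k + 1) ∨
    (nu (Gbeta G) = k + 1 ∧ nu (Ggamma G) = k + 1) := by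
  obtain ⟨R, hR⟩ : nu G ∈ {n : ℕ | ∃ R : IntervalRep G, R.nesting = n} := by
    obtain ⟨R0⟩ := hG
    exact Nat.sInf_mem ⟨_, R0, rfl⟩
  obtain ⟨S, hS⟩ := exists_extend R
  have h1 : nu (Ggamma G) ≤ S.nesting := Nat.sInf_le ⟨_, rfl⟩
  have h2 : nu (Gbeta G) ≤ nu (Ggamma G) := nu_mono (embGamma G) ⟨S⟩
  have h3 : nu G ≤ nu (Gbeta G) := nu_mono (embBeta G) ⟨restrictRep (embGamma G) S⟩
  omega
end

section
/- In every interval representation of G_α, the interval of every vertex of G is strictly contained (as a set) in the interval of the added vertex u; in particular, neither endpoint of the interval of u belongs to the interval of any vertex of G. -/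
open Set

theorem IntervalRep.adj_iff_le {V : Type*} {G : SimpleGraph V} (R : IntervalRep G) (u v : V)
    (h : u ≠ v) : G.Adj u v ↔ (R.l u ≤ R.r v ∧ R.l v ≤ R.r u) := by
  rw [R.adj_iff u v h]
  have hu := R.le u
  have hv := R.le v
  rw [Set.Icc_inter_Icc, Set.nonempty_Icc, sup_le_iff, le_inf_iff, le_inf_iff]
  tauto

/-- in every representation of `G_α`, the interval of every vertex of `G` is
strictly contained in the interval of `u`; in particular, neither endpoint of `I(u)` belongs
to the interval of any vertex of `G`. -/
theorem stmt_3 {V : Type*} [Fintype V] (G : SimpleGraph V)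
    (R : IntervalRep (Galpha G)) (x : V) :
    R.itv (Sum.inl x) ⊂ R.itv (Sum.inr 0) ∧
    R.l (Sum.inr 0) ∉ R.itv (Sum.inl x) ∧ R.r (Sum.inr 0) ∉ R.itv (Sum.inl x) := by
  have hux := R.adj_iff_le (Sum.inr 0) (Sum.inl x) (by simp)
  have hua := R.adj_iff_le (Sum.inr 0) (Sum.inr 1) (by simp)
  have hub := R.adj_iff_le (Sum.inr 0) (Sum.inr 3) (by simp)
  have haa := R.adj_iff_le (Sum.inr 1) (Sum.inr 2) (by simp)
  have hbb := R.adj_iff_le (Sum.inr 3) (Sum.inr 4) (by simp)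
  have nua := R.adj_iff_le (Sum.inr 0) (Sum.inr 2) (by simp)
  have nub := R.adj_iff_le (Sum.inr 0) (Sum.inr 4) (by simp)
  have nab := R.adj_iff_le (Sum.inr 1) (Sum.inr 3) (by simp)
  have nxa := R.adj_iff_le (Sum.inl x) (Sum.inr 1) (by simp)
  have nxb := R.adj_iff_le (Sum.inl x) (Sum.inr 3) (by simp)
  simp [Galpha] at hux hua hub haa hbb nua nub nab nxa nxb
  have hu := R.le (Sum.inr 0)
  have hx := R.le (Sum.inl x)
  have key : R.l (Sum.inr 0) < R.l (Sum.inl x) ∧ R.r (Sum.inl x) < R.r (Sum.inr 0) := by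
    have h1 := R.le (Sum.inr 1)
    have h2 := R.le (Sum.inr 2)
    have h3 := R.le (Sum.inr 3)
    have h4 := R.le (Sum.inr 4)
    simp only [imp_iff_not_or, not_le] at nua nub nab nxa nxb
    rcases nua with nua | nua <;> rcases nub with nub | nub <;> rcases nab with nab | nab <;>
      rcases nxa with nxa | nxa <;> rcases nxb with nxb | nxb <;> constructor <;> linarith
  obtain ⟨k1, k2⟩ := key
  have hl : R.l (Sum.inr 0) ∉ R.itv (Sum.inl x) := fun h => absurd h.1 (not_le.mpr k1)
  have hr : R.r (Sum.inr 0) ∉ R.itv (Sum.inl x) := fun h => absurd h.2 (not_le.mpr k2)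
  refine ⟨⟨fun t ht => ⟨k1.le.trans ht.1, ht.2.trans k2.le⟩, fun h => hl (h ⟨le_rfl, hu⟩)⟩, hl, hr⟩
end

section
/- Let G₁, …, G_p (p ≥ 2) be nonempty connected interval graphs and let G = G₁ ⊔ ⋯ ⊔ G_p be their disjoint union. Then ν(G_β) = min over indices s of max({ν((G_s)_β)} ∪ {ν(G_i) + 1 : i ≠ s}). -/
open Set

namespace IntervalRep

variable {V : Type*} {G : SimpleGraph V}

/-- Chains of strictly nested intervals. -/
def IsChainOf (R : IntervalRep G) {k : ℕ} (f : Fin k → V) : Prop :=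
  ∀ i j : Fin k, i < j → R.itv (f i) ⊂ R.itv (f j)

theorem itv_ssubset_iff (R : IntervalRep G) (x y : V) :
    R.itv x ⊂ R.itv y ↔ R.l y ≤ R.l x ∧ R.r x ≤ R.r y ∧ (R.l y < R.l x ∨ R.r x < R.r y) := by
  have hx := R.le x
  have hy := R.le y
  rw [ssubset_iff_subset_not_subset]
  unfold itv
  rw [Icc_subset_Icc_iff hx, Icc_subset_Icc_iff hy]
  constructor
  · rintro ⟨⟨h1, h2⟩, h3⟩
    refine ⟨h1, h2, ?_⟩
    by_contra h
    push Not at h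
    exact h3 ⟨h.1, h.2⟩
  · rintro ⟨h1, h2, h3⟩
    refine ⟨⟨h1, h2⟩, ?_⟩
    rintro ⟨h4, h5⟩
    rcases h3 with h | h <;> linarith

theorem meet_iff (a b c d : ℝ) (h1 : a ≤ b) (h2 : c ≤ d) :
    (Icc a b ∩ Icc c d).Nonempty ↔ a ≤ d ∧ c ≤ b := by
  constructor
  · rintro ⟨x, ⟨h3, h4⟩, h5, h6⟩
    exact ⟨h3.trans h6, h5.trans h4⟩
  · rintro ⟨h3, h4⟩
    exact ⟨max a c, ⟨le_max_left _ _, max_le h1 h4⟩, le_max_right _ _, max_le h3 h2⟩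

theorem adj_iff' (R : IntervalRep G) {x y : V} (h : x ≠ y) :
    G.Adj x y ↔ R.l x ≤ R.r y ∧ R.l y ≤ R.r x := by
  rw [R.adj_iff x y h, meet_iff _ _ _ _ (R.le x) (R.le y)]

theorem IsChainOf.injective {R : IntervalRep G} {k : ℕ} {f : Fin k → V} (h : R.IsChainOf f) :
    Function.Injective f := by
  intro i j hij
  rcases lt_trichotomy i j with h1 | h1 | h1
  · have := h i j h1
    rw [hij] at this
    exact absurd this (ssubset_irrefl _)
  · exact h1
  · have := h j i h1
    rw [hij] at this
    exact absurd this (ssubset_irrefl _)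

theorem bddAbove_chain [Finite V] (R : IntervalRep G) :
    BddAbove {k : ℕ | ∃ f : Fin k → V, ∀ i j : Fin k, i < j → R.itv (f i) ⊂ R.itv (f j)} := by
  refine ⟨Nat.card V, ?_⟩
  rintro k ⟨f, hf⟩
  have hi : Function.Injective f := IsChainOf.injective (R := R) hf
  simpa using Nat.card_le_card_of_injective f hi

theorem le_nesting [Finite V] (R : IntervalRep G) {k : ℕ} {f : Fin k → V}
    (h : R.IsChainOf f) : k ≤ R.nesting :=
  le_csSup R.bddAbove_chain ⟨f, h⟩

theorem exists_chain [Finite V] (R : IntervalRep G) :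
    ∃ f : Fin R.nesting → V, R.IsChainOf f :=
  Nat.sSup_mem (s := {k : ℕ | ∃ f : Fin k → V, ∀ i j : Fin k, i < j → R.itv (f i) ⊂ R.itv (f j)})
    ⟨0, fun i => i.elim0, fun i => i.elim0⟩ R.bddAbove_chain

theorem nu_le (R : IntervalRep G) : nu G ≤ R.nesting := Nat.sInf_le ⟨R, rfl⟩

theorem exists_nu (h : IsIntervalGraph G) : ∃ R : IntervalRep G, R.nesting = nu G := by
  obtain ⟨R⟩ := h
  exact Nat.sInf_mem (s := {n : ℕ | ∃ R : IntervalRep G, R.nesting = n}) ⟨_, R, rfl⟩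

/-- Pull back along an embedding. -/
def comap (R : IntervalRep G) {W : Type*} (H : SimpleGraph W) (φ : W → V)
    (hφ : Function.Injective φ) (hadj : ∀ a b, H.Adj a b ↔ G.Adj (φ a) (φ b)) :
    IntervalRep H where
  l := fun w => R.l (φ w)
  r := fun w => R.r (φ w)
  le := fun w => R.le _
  adj_iff := fun a b hab => by
    rw [hadj, R.adj_iff _ _ (fun h => hab (hφ h))]

/-- Reflection. -/
def neg (R : IntervalRep G) : IntervalRep G where
  l := fun v => - R.r v
  r := fun v => - R.l v
  le := fun v => neg_le_neg (R.le v)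
  adj_iff := fun a b hab => by
    rw [R.adj_iff' hab, meet_iff _ _ _ _ (neg_le_neg (R.le a)) (neg_le_neg (R.le b))]
    constructor
    · rintro ⟨h1, h2⟩
      constructor <;> linarith
    · rintro ⟨h1, h2⟩
      constructor <;> linarith

theorem neg_nesting (R : IntervalRep G) : R.neg.nesting = R.nesting := by
  have : ∀ x y, R.neg.itv x ⊂ R.neg.itv y ↔ R.itv x ⊂ R.itv y := by
    intro x y
    rw [itv_ssubset_iff, itv_ssubset_iff]
    simp only [neg, neg_le_neg_iff, neg_lt_neg_iff]
    tauto
  unfold nesting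
  simp only [this]

end IntervalRep

section Adj

theorem Gbeta_inl_inl {V : Type*} (G : SimpleGraph V) (a b : V) :
    (Gbeta G).Adj (Sum.inl a) (Sum.inl b) ↔ G.Adj a b := by
  simp only [Gbeta, SimpleGraph.fromRel_adj]
  constructor
  · rintro ⟨_, h | h⟩
    · exact h
    · exact h.symm
  · intro h
    exact ⟨fun h' => h.ne (Sum.inl_injective h'), Or.inl h⟩

theorem Gbeta_inl_inr {V : Type*} (G : SimpleGraph V) (a : V) (i : Fin 3) :
    (Gbeta G).Adj (Sum.inl a) (Sum.inr i) ↔ i = 0 := by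
  simp [Gbeta, SimpleGraph.fromRel_adj]

theorem Gbeta_inr_inr {V : Type*} (G : SimpleGraph V) (i j : Fin 3) :
    (Gbeta G).Adj (Sum.inr i) (Sum.inr j) ↔
      (i = 0 ∧ j = 1 ∨ i = 1 ∧ j = 2) ∨ (j = 0 ∧ i = 1 ∨ j = 1 ∧ i = 2) := by
  simp only [Gbeta, SimpleGraph.fromRel_adj]
  constructor
  · exact fun h => h.2
  · intro h
    refine ⟨fun h' => ?_, h⟩
    have := Sum.inr_injective h'
    subst this
    revert h
    fin_cases i <;> simp

theorem sigma_adj_same {p : ℕ} {V : Fin p → Type*} (G : ∀ i, SimpleGraph (V i)) (i : Fin p)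
    (x y : V i) : (sigmaGraph G).Adj ⟨i, x⟩ ⟨i, y⟩ ↔ (G i).Adj x y := by
  simp only [sigmaGraph, SimpleGraph.fromRel_adj]
  constructor
  · rintro ⟨_, ⟨_, h⟩ | ⟨_, h⟩⟩
    · exact h
    · exact h.symm
  · intro h
    refine ⟨?_, Or.inl ⟨trivial, h⟩⟩
    intro h'
    exact h.ne (by simpa using h')

theorem sigma_adj_ne {p : ℕ} {V : Fin p → Type*} (G : ∀ i, SimpleGraph (V i)) (i j : Fin p)
    (hij : i ≠ j) (x : V i) (y : V j) : ¬ (sigmaGraph G).Adj ⟨i, x⟩ ⟨j, y⟩ := by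
  simp only [sigmaGraph, SimpleGraph.fromRel_adj]
  rintro ⟨_, ⟨h, _⟩ | ⟨h, _⟩⟩
  · exact hij h
  · exact hij h.symm

end Adj

/-- A representation of `G_β` in which `a₂` is on the right of `u`. -/
def Oriented {V : Type*} {G : SimpleGraph V} (R : IntervalRep (Gbeta G)) : Prop :=
  R.r (Sum.inr 0) < R.l (Sum.inr 2)

theorem exists_oriented {V : Type*} {G : SimpleGraph V} (R : IntervalRep (Gbeta G)) :
    ∃ R' : IntervalRep (Gbeta G), R'.nesting = R.nesting ∧ Oriented R' := by
  by_cases h : Oriented R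
  · exact ⟨R, rfl, h⟩
  · refine ⟨R.neg, R.neg_nesting, ?_⟩
    have h1 : ¬ (Gbeta G).Adj (Sum.inr 0) (Sum.inr 2) := by
      rw [Gbeta_inr_inr]; decide
    rw [R.adj_iff' (by simp)] at h1
    unfold Oriented at h ⊢
    simp only [IntervalRep.neg]
    push Not at h h1
    by_contra h2
    push Not at h2
    have := h1 (by linarith)
    linarith

theorem Oriented.facts {V : Type*} {G : SimpleGraph V} {R : IntervalRep (Gbeta G)}
    (h : Oriented R) :
    R.l (Sum.inr 1) ≤ R.r (Sum.inr 0) ∧ R.r (Sum.inr 0) < R.l (Sum.inr 2) ∧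
    R.l (Sum.inr 2) ≤ R.r (Sum.inr 1) ∧
    ∀ x : V, R.r (Sum.inl x) < R.l (Sum.inr 1) ∧ R.l (Sum.inr 0) ≤ R.r (Sum.inl x) := by
  have h01 : (Gbeta G).Adj (Sum.inr 0) (Sum.inr 1) := by rw [Gbeta_inr_inr]; decide
  have h12 : (Gbeta G).Adj (Sum.inr 1) (Sum.inr 2) := by rw [Gbeta_inr_inr]; decide
  rw [R.adj_iff' (by simp)] at h01 h12
  unfold Oriented at h
  refine ⟨h01.2, h, h12.2, fun x => ?_⟩
  have hx0 : (Gbeta G).Adj (Sum.inl x) (Sum.inr 0) := by rw [Gbeta_inl_inr]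
  have hx1 : ¬ (Gbeta G).Adj (Sum.inl x) (Sum.inr 1) := by rw [Gbeta_inl_inr]; decide
  rw [R.adj_iff' (by simp)] at hx0 hx1
  refine ⟨?_, hx0.2⟩
  by_contra h3
  push Not at h3
  exact hx1 ⟨by linarith, h3⟩

theorem exists_slots (p : ℕ) (M A : ℝ) (h : M < A) :
    ∃ e : Fin p → ℝ → ℝ, (∀ i, StrictMono (e i)) ∧ (∀ i t, M < e i t) ∧ (∀ i t, e i t < A) ∧
      ∀ i j t t', i < j → e i t < e j t' := by
  have hd : 0 < A - M := by linarith
  have hp : ∀ i : Fin p, (0 : ℝ) < p := fun i => by exact_mod_cast (Nat.zero_le _).trans_lt i.2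
  refine ⟨fun i t => M + (A - M) * (((i : ℕ) + Real.sigmoid t) / p), ?_, ?_, ?_, ?_⟩
  · intro i t t' htt
    have := Real.sigmoid_strictMono htt
    have := hp i
    simp only
    gcongr
  · intro i t
    have := hp i
    have := Real.sigmoid_pos t
    have : 0 < (A - M) * (((i : ℕ) + Real.sigmoid t) / p) := by positivity
    linarith
  · intro i t
    have h0 := hp i
    have h1 := Real.sigmoid_lt_one t
    have h2 : ((i : ℕ) : ℝ) + 1 ≤ p := by exact_mod_cast i.2
    have : (((i : ℕ) + Real.sigmoid t) / p) < 1 := by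
      rw [div_lt_one h0]; linarith
    nlinarith
  · intro i j t t' hij
    have h0 := hp i
    have h1 := Real.sigmoid_lt_one t
    have h3 := Real.sigmoid_pos t'
    have h2 : ((i : ℕ) : ℝ) + 1 ≤ (j : ℕ) := by exact_mod_cast hij
    have : (i : ℕ) + Real.sigmoid t < (j : ℕ) + Real.sigmoid t' := by linarith
    simp only
    gcongr

theorem isInterval_Gbeta {V : Type*} {G : SimpleGraph V} (h : IsIntervalGraph G) :
    IsIntervalGraph (Gbeta G) := by
  obtain ⟨R⟩ := h
  obtain ⟨e, he, h0, h1, -⟩ := exists_slots 1 0 1 one_pos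
  refine ⟨⟨Sum.elim (fun v => e 0 (R.l v)) ![0, 2, 4], Sum.elim (fun v => e 0 (R.r v)) ![3, 5, 6],
    ?_, ?_⟩⟩
  · rintro (v | i)
    · exact (he 0).monotone (R.le v)
    · fin_cases i <;> simp <;> norm_num
  · have hle : ∀ v, e 0 (R.l v) ≤ e 0 (R.r v) := fun v => (he 0).monotone (R.le v)
    have hmix : ∀ (v : V) (i : Fin 3), i = 0 ↔
        e 0 (R.l v) ≤ ![(3 : ℝ), 5, 6] i ∧ ![(0 : ℝ), 2, 4] i ≤ e 0 (R.r v) := by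
      intro v i
      have a1 := h0 0 (R.l v)
      have a2 := h1 0 (R.l v)
      have a3 := h0 0 (R.r v)
      have a4 := h1 0 (R.r v)
      fin_cases i <;> simp <;> (try constructor) <;> intros <;> linarith
    have h3 : ∀ i : Fin 3, ![(0 : ℝ), 2, 4] i ≤ ![(3 : ℝ), 5, 6] i := by
      intro i
      fin_cases i <;> simp <;> norm_num
    rintro (v | i) (w | j) hne
    · rw [Gbeta_inl_inl, R.adj_iff' (fun h => hne (by rw [h]))]
      simp only [Sum.elim_inl]
      rw [IntervalRep.meet_iff _ _ _ _ (hle v) (hle w), (he 0).le_iff_le, (he 0).le_iff_le]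
    · rw [Gbeta_inl_inr]
      simp only [Sum.elim_inl, Sum.elim_inr]
      rw [IntervalRep.meet_iff _ _ _ _ (hle v) (h3 j)]
      exact hmix v j
    · rw [SimpleGraph.adj_comm, Gbeta_inl_inr]
      simp only [Sum.elim_inl, Sum.elim_inr]
      rw [IntervalRep.meet_iff _ _ _ _ (h3 i) (hle w), and_comm]
      exact hmix w i
    · rw [Gbeta_inr_inr]
      simp only [Sum.elim_inr]
      rw [IntervalRep.meet_iff _ _ _ _ (h3 i) (h3 j)]
      fin_cases i <;> fin_cases j <;> simp at hne ⊢ <;> norm_num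

/-- Lower bound. -/
theorem lower {p : ℕ} (hp : 2 ≤ p) {V : Fin p → Type*} [∀ i, Fintype (V i)]
    [∀ i, Nonempty (V i)] (G : ∀ i, SimpleGraph (V i))
    (R : IntervalRep (Gbeta (sigmaGraph G))) :
    ∃ s : Fin p, max (nu (Gbeta (G s))) ((Finset.univ \ {s}).sup fun i => nu (G i) + 1)
      ≤ R.nesting := by
  obtain ⟨R, hR, ho⟩ := exists_oriented R
  rw [← hR]
  clear hR
  obtain ⟨f1, f2, f3, f4⟩ := ho.facts
  have : Nonempty (Σ i, V i) := ⟨⟨⟨0, by omega⟩, Classical.arbitrary _⟩⟩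
  obtain ⟨⟨s, y⟩, hy⟩ := Finite.exists_min (fun x : Σ i, V i => R.r (Sum.inl x))
  refine ⟨s, max_le ?_ (Finset.sup_le ?_)⟩
  · let φ : V s ⊕ Fin 3 → (Σ i, V i) ⊕ Fin 3 := Sum.map (fun x => ⟨s, x⟩) id
    have hφ : Function.Injective φ :=
      Sum.map_injective.2 ⟨sigma_mk_injective, Function.injective_id⟩
    let S := R.comap (Gbeta (G s)) φ hφ (by
      rintro (a | a) (b | b)
      · simp only [φ, Sum.map_inl]
        rw [Gbeta_inl_inl, Gbeta_inl_inl, sigma_adj_same]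
      · simp only [φ, Sum.map_inl, Sum.map_inr, id]
        rw [Gbeta_inl_inr, Gbeta_inl_inr]
      · simp only [φ, Sum.map_inl, Sum.map_inr, id]
        rw [SimpleGraph.adj_comm, Gbeta_inl_inr, SimpleGraph.adj_comm, Gbeta_inl_inr]
      · simp only [φ, Sum.map_inr, id]
        rw [Gbeta_inr_inr, Gbeta_inr_inr])
    obtain ⟨f, hf⟩ := S.exists_chain
    exact S.nu_le.trans (R.le_nesting (f := φ ∘ f) hf)
  · intro i hi
    have his : i ≠ s := by simpa using hi
    let φ : V i → (Σ i, V i) ⊕ Fin 3 := fun x => Sum.inl ⟨i, x⟩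
    have hφ : Function.Injective φ := Sum.inl_injective.comp sigma_mk_injective
    let S := R.comap (G i) φ hφ (by
      intro a b
      simp only [φ]
      rw [Gbeta_inl_inl, sigma_adj_same])
    obtain ⟨f, hf⟩ := S.exists_chain
    refine (Nat.succ_le_succ S.nu_le).trans
      (R.le_nesting (f := Fin.snoc (α := fun _ => (Σ i, V i) ⊕ Fin 3) (φ ∘ f) (Sum.inr 0)) ?_)
    intro a b hab
    induction a using Fin.lastCases with
    | last => exact absurd hab (not_lt.2 (Fin.le_last _))
    | cast a =>
      induction b using Fin.lastCases with
      | last =>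
        simp only [Fin.snoc_castSucc, Fin.snoc_last, Function.comp, φ]
        rw [IntervalRep.itv_ssubset_iff]
        have hn : ¬ (Gbeta (sigmaGraph G)).Adj (Sum.inl ⟨s, y⟩) (Sum.inl ⟨i, f a⟩) := by
          rw [Gbeta_inl_inl]
          exact sigma_adj_ne G s i his.symm _ _
        rw [R.adj_iff' (by
          intro h
          exact his (congrArg Sigma.fst (Sum.inl_injective h)).symm)] at hn
        have h1 := hy ⟨i, f a⟩
        have h2 := f4 ⟨i, f a⟩
        have h3 := f4 ⟨s, y⟩
        have h4 := R.le (Sum.inl ⟨s, y⟩)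
        have h5 : R.r (Sum.inl ⟨s, y⟩) < R.l (Sum.inl ⟨i, f a⟩) := by
          by_contra h
          push Not at h
          exact hn ⟨h4.trans h1, h⟩
        exact ⟨by linarith, by linarith, Or.inr (by linarith)⟩
      | cast b =>
        simp only [Fin.snoc_castSucc]
        exact hf a b (by simpa using hab)

/-- Upper bound. -/
theorem upper {p : ℕ} {V : Fin p → Type*} [∀ i, Fintype (V i)]
    [∀ i, Nonempty (V i)] (G : ∀ i, SimpleGraph (V i)) (s : Fin p)
    (Rs : IntervalRep (Gbeta (G s))) (R : ∀ i, IntervalRep (G i)) :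
    ∃ S : IntervalRep (Gbeta (sigmaGraph G)), S.nesting ≤
      max Rs.nesting ((Finset.univ \ {s}).sup fun i => (R i).nesting + 1) := by
  obtain ⟨Rs, hR, ho⟩ := exists_oriented Rs
  rw [← hR]
  clear hR
  obtain ⟨f1, f2, f3, f4⟩ := ho.facts
  obtain ⟨m, hm⟩ := Finite.exists_max (fun x : V s => Rs.r (Sum.inl x))
  obtain ⟨e, he, heM, heA, hlt⟩ := exists_slots p _ _ (f4 m).1
  have huM := (f4 m).2
  set M := Rs.r (Sum.inl m) with hM
  let L : ∀ i, V i → ℝ := Function.update (fun i x => e i ((R i).l x)) s (fun x => Rs.l (Sum.inl x))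
  let T : ∀ i, V i → ℝ := Function.update (fun i x => e i ((R i).r x)) s (fun x => Rs.r (Sum.inl x))
  have Ls : ∀ x, L s x = Rs.l (Sum.inl x) := fun x => by simp [L]
  have Ts : ∀ x, T s x = Rs.r (Sum.inl x) := fun x => by simp [T]
  have Li : ∀ i, i ≠ s → ∀ x, L i x = e i ((R i).l x) := fun i hi x => by
    simp only [L, Function.update_of_ne hi]
  have Ti : ∀ i, i ≠ s → ∀ x, T i x = e i ((R i).r x) := fun i hi x => by
    simp only [T, Function.update_of_ne hi]
  have hLT : ∀ i x, L i x ≤ T i x := by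
    intro i x
    by_cases hi : i = s
    · subst hi
      rw [Ls, Ts]
      exact Rs.le _
    · rw [Li i hi, Ti i hi]
      exact (he i).monotone ((R i).le x)
  have hdisj : ∀ i j, i ≠ j → ∀ x y, T i x < L j y ∨ T j y < L i x := by
    intro i j hij x y
    by_cases hi : i = s
    · subst hi
      left
      rw [Ts, Li j hij.symm]
      exact (hm x).trans_lt (heM _ _)
    · by_cases hj : j = s
      · subst hj
        right
        rw [Ts, Li i hi]
        exact (hm y).trans_lt (heM _ _)
      · rw [Ti i hi, Li j hj, Li i hi, Ti j hj]
        rcases lt_or_gt_of_ne hij with h | h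
        · exact Or.inl (hlt _ _ _ _ h)
        · exact Or.inr (hlt _ _ _ _ h)
  have hmix : ∀ (i) (x : V i) (k : Fin 3), k = 0 ↔
      L i x ≤ Rs.r (Sum.inr k) ∧ Rs.l (Sum.inr k) ≤ T i x := by
    intro i x k
    by_cases hi : i = s
    · subst hi
      rw [Ls, Ts, ← Rs.adj_iff' (by simp), Gbeta_inl_inr]
    · rw [Li i hi, Ti i hi]
      have a1 := heM i ((R i).l x)
      have a2 := heA i ((R i).l x)
      have a3 := heM i ((R i).r x)
      have a4 := heA i ((R i).r x)
      fin_cases k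
      · simp only [Fin.zero_eta, true_iff]
        constructor <;> linarith
      · simp only [Fin.mk_one, one_ne_zero, false_iff]
        intro h
        linarith [h.2]
      · simp only [Fin.reduceFinMk, Fin.reduceEq, false_iff]
        intro h
        linarith [h.2]
  let S : IntervalRep (Gbeta (sigmaGraph G)) :=
    { l := Sum.elim (fun x => L x.1 x.2) (fun k => Rs.l (Sum.inr k))
      r := Sum.elim (fun x => T x.1 x.2) (fun k => Rs.r (Sum.inr k))
      le := by
        rintro (⟨i, x⟩ | k)
        · exact hLT i x
        · exact Rs.le _
      adj_iff := by
        rintro (⟨i, x⟩ | k) (⟨j, y⟩ | k') hne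
        · simp only [Sum.elim_inl]
          rw [Gbeta_inl_inl, IntervalRep.meet_iff _ _ _ _ (hLT i x) (hLT j y)]
          by_cases hij : i = j
          · subst hij
            have hxy : x ≠ y := by
              rintro rfl
              exact hne rfl
            rw [sigma_adj_same]
            by_cases hi : i = s
            · subst hi
              rw [Ls, Ls, Ts, Ts, ← Rs.adj_iff' (by simpa using hxy), Gbeta_inl_inl]
            · rw [Li i hi, Li i hi, Ti i hi, Ti i hi, (he i).le_iff_le, (he i).le_iff_le,
                (R i).adj_iff' hxy]
          · constructor
            · intro h
              exact absurd h (sigma_adj_ne G i j hij x y)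
            · rintro ⟨h1, h2⟩
              rcases hdisj i j hij x y with h | h <;> linarith
        · simp only [Sum.elim_inl, Sum.elim_inr]
          rw [Gbeta_inl_inr, IntervalRep.meet_iff _ _ _ _ (hLT i x) (Rs.le _)]
          exact hmix i x k'
        · simp only [Sum.elim_inl, Sum.elim_inr]
          rw [SimpleGraph.adj_comm, Gbeta_inl_inr,
            IntervalRep.meet_iff _ _ _ _ (Rs.le _) (hLT j y), and_comm]
          exact hmix j y k
        · simp only [Sum.elim_inr]
          rw [Gbeta_inr_inr, ← Gbeta_inr_inr (G s)]
          exact Rs.adj_iff _ _ (by simpa using hne) }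
  refine ⟨S, ?_⟩
  have SlV : ∀ i x, S.l (Sum.inl ⟨i, x⟩) = L i x := fun _ _ => rfl
  have SrV : ∀ i x, S.r (Sum.inl ⟨i, x⟩) = T i x := fun _ _ => rfl
  have SlF : ∀ k, S.l (Sum.inr k) = Rs.l (Sum.inr k) := fun _ => rfl
  have SrF : ∀ k, S.r (Sum.inr k) = Rs.r (Sum.inr k) := fun _ => rfl
  obtain ⟨f, hf⟩ := S.exists_chain
  by_cases hcase : ∃ j i x, i ≠ s ∧ f j = Sum.inl ⟨i, x⟩
  · obtain ⟨j, i, x, his, hj⟩ := hcase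
    refine le_max_of_le_right (le_trans ?_
      (Finset.le_sup (f := fun i => (R i).nesting + 1) (b := i) (by simpa using his)))
    -- every chain member is in `G i` or equal to `u`
    have hmem : ∀ t, (∃ y, f t = Sum.inl ⟨i, y⟩) ∨ f t = Sum.inr 0 := by
      intro t
      by_cases htj : t = j
      · subst htj
        exact Or.inl ⟨x, hj⟩
      have hmeet : S.l (f t) ≤ S.r (f j) ∧ S.l (f j) ≤ S.r (f t) := by
        have b1 := S.le (f t)
        have b2 := S.le (f j)
        rcases lt_or_gt_of_ne htj with h | h
        · have := (S.itv_ssubset_iff _ _).1 (hf t j h)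
          constructor <;> linarith [this.1, this.2.1]
        · have := (S.itv_ssubset_iff _ _).1 (hf j t h)
          constructor <;> linarith [this.1, this.2.1]
      rw [hj] at hmeet
      rcases hft : f t with ⟨i', y⟩ | k
      · left
        rw [hft, SlV, SrV, SlV, SrV] at hmeet
        by_cases hii : i' = i
        · subst hii
          exact ⟨y, rfl⟩
        · rcases hdisj i' i hii y x with h | h <;> linarith [hmeet.1, hmeet.2]
      · right
        rw [hft, SlF, SrV, SlV, SrF] at hmeet
        rw [(hmix i x k).2 ⟨hmeet.2, hmeet.1⟩]
    have hlast : ∀ t t', t < t' → ∃ y, f t = Sum.inl ⟨i, y⟩ := by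
      intro t t' htt
      rcases hmem t with h | h
      · exact h
      · exfalso
        have h1 := hf t t' htt
        rcases hmem t' with ⟨y, h'⟩ | h'
        · rw [h, h', S.itv_ssubset_iff, SlV, SrV, SlF, SrF, Li i his] at h1
          linarith [h1.1, heM i ((R i).l y)]
        · rw [h, h'] at h1
          exact ssubset_irrefl _ h1
    clear hmem hj
    clear j
    generalize S.nesting = n at f hf hlast ⊢
    rcases n with _ | n
    · omega
    · have : ∀ t : Fin n, ∃ y, f t.castSucc = Sum.inl ⟨i, y⟩ :=
        fun t => hlast _ (Fin.last n) (Fin.castSucc_lt_last t)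
      choose g hg using this
      refine Nat.succ_le_succ ((R i).le_nesting (f := g) ?_)
      intro a b hab
      have h1 := hf a.castSucc b.castSucc (by simpa using hab)
      rw [hg, hg, S.itv_ssubset_iff, SlV, SrV, SlV, SrV, Li i his, Li i his, Ti i his, Ti i his,
        (he i).le_iff_le, (he i).le_iff_le, (he i).lt_iff_lt, (he i).lt_iff_lt] at h1
      rw [(R i).itv_ssubset_iff]
      exact h1
  · refine le_max_of_le_left ?_
    push Not at hcase
    have : ∀ t, ∃ z : V s ⊕ Fin 3, S.l (f t) = Rs.l z ∧ S.r (f t) = Rs.r z := by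
      intro t
      rcases hft : f t with ⟨i, y⟩ | k
      · by_cases hi : i = s
        · subst hi
          exact ⟨Sum.inl y, by rw [SlV, Ls], by rw [SrV, Ts]⟩
        · exact absurd hft (hcase t i y hi)
      · exact ⟨Sum.inr k, SlF k, SrF k⟩
    choose g hg1 hg2 using this
    refine Rs.le_nesting (f := g) ?_
    intro a b hab
    have h1 := hf a b hab
    rw [S.itv_ssubset_iff, hg1, hg1, hg2, hg2] at h1
    rw [Rs.itv_ssubset_iff]
    exact h1

/-- for nonempty connected interval graphs `G₁, …, G_p` (`p ≥ 2`) and `G`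
their disjoint union, `ν(G_β) = min_s max({ν((G_s)_β)} ∪ {ν(G_i) + 1 : i ≠ s})`. -/
theorem stmt_14 {p : ℕ} (hp : 2 ≤ p) {V : Fin p → Type*} [∀ i, Fintype (V i)]
    [∀ i, Nonempty (V i)] (G : ∀ i, SimpleGraph (V i))
    (hconn : ∀ i, (G i).Connected) (hG : ∀ i, IsIntervalGraph (G i)) :
    nu (Gbeta (sigmaGraph G)) =
      sInf {m : ℕ | ∃ s : Fin p,
        m = max (nu (Gbeta (G s))) ((Finset.univ \ {s}).sup fun i => nu (G i) + 1)} := by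
  apply le_antisymm
  · have hne : {m : ℕ | ∃ s : Fin p, m = max (nu (Gbeta (G s)))
        ((Finset.univ \ {s}).sup fun i => nu (G i) + 1)}.Nonempty := ⟨_, ⟨0, by omega⟩, rfl⟩
    obtain ⟨s, hs⟩ := Nat.sInf_mem hne
    rw [hs]
    obtain ⟨Rs, hRs⟩ := IntervalRep.exists_nu (isInterval_Gbeta (hG s))
    choose R hR using fun i => IntervalRep.exists_nu (hG i)
    obtain ⟨S, hS⟩ := upper G s Rs R
    simp only [hRs, hR] at hS
    exact S.nu_le.trans hS
  · let s0 : Fin p := ⟨0, by omega⟩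
    obtain ⟨S0, -⟩ := upper G s0 (isInterval_Gbeta (hG s0)).some (fun i => (hG i).some)
    obtain ⟨S, hS⟩ := IntervalRep.exists_nu (G := Gbeta (sigmaGraph G)) ⟨S0⟩
    obtain ⟨s, hs⟩ := lower hp G S
    rw [← hS]
    refine le_trans (Nat.sInf_le ?_) hs
    exact ⟨s, rfl⟩
end
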